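/- arXiv:2312.03949 — 3 statements merged into one kernel-verified Lean document; each statement's English description precedes it below -/
import Mathlib

section
/- Scholz's reciprocity law: Let p and q be distinct primes with p ≢ 3 (mod 4) and q ≢ 3 (mod 4), q odd, and suppose (p/q) = 1 (so that q splits in ℚ(√p), and also (q/p) = 1). Then for every ring homomorphism φ from the ring of integers of ℚ(√p) to the field 𝔽_q, the image φ(ε_p) is a nonzero square in 𝔽_q if and only if (p/q)₄ (q/p)₄ = 1. -/
open scoped Classical in
noncomputable def legSym (a : ℤ) (p : ℕ) : ℤ :=
  if p = 2 then (if a % 8 = 1 ∨ a % 8 = 7 then 1 else -1)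
  else if ∃ x : ℤ, (p : ℤ) ∣ (x ^ 2 - a) then 1 else -1

open scoped Classical in
noncomputable def quartSym (a : ℤ) (p : ℕ) : ℤ :=
  if p = 2 then (if a % 16 = 1 ∨ a % 16 = 15 then 1 else -1)
  else if ∃ x : ℤ, (p : ℤ) ∣ (x ^ 4 - a) then 1 else -1

def InO (m : ℕ) (x : ℝ) : Prop :=
  (∃ a b : ℚ, x = (a : ℝ) + (b : ℝ) * Real.sqrt m) ∧ IsIntegral ℤ x

/-- `ε` is the fundamental unit `> 1` of the ring of integers of `ℚ(√m) ⊆ ℝ`. -/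
def IsFundUnit (m : ℕ) (ε : ℝ) : Prop :=
  InO m ε ∧ InO m ε⁻¹ ∧ 1 < ε ∧
    ∀ u : ℝ, InO m u → InO m u⁻¹ → ∃ n : ℤ, u = ε ^ n ∨ u = -(ε ^ n)

/-- The norm of `ε ∈ ℚ(√m)` from `ℚ(√m)` to `ℚ` equals `-1`. -/
def NormNegOne (m : ℕ) (ε : ℝ) : Prop :=
  ∃ a b : ℚ, ε = (a : ℝ) + (b : ℝ) * Real.sqrt m ∧ a ^ 2 - (m : ℚ) * b ^ 2 = -1

open scoped NumberTheorySymbols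

theorem Nat.Prime.dvd_of_sq_dvd_mul_sq {l q z : ℕ} (hl : l.Prime) (hq : q.Prime)
    (h : l ^ 2 ∣ q * z ^ 2) : l ∣ z := by
  by_contra hz
  have hc : Nat.Coprime (l ^ 2) (z ^ 2) := ((Nat.Prime.coprime_iff_not_dvd hl).2 hz).pow 2 2
  have h1 : l ^ 2 ∣ q := hc.dvd_of_dvd_mul_right h
  rw [sq] at h1
  have := (Nat.squarefree_iff_prime_squarefree.1 hq.prime.squarefree) l hl
  exact this h1

theorem exists_coprime_sq_eq {p q : ℕ} (hq : q.Prime) :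
    ∀ x y z : ℕ, x ≠ 0 → x ^ 2 = p * y ^ 2 + q * z ^ 2 →
      ∃ x y z : ℕ, Nat.Coprime x y ∧ x ^ 2 = p * y ^ 2 + q * z ^ 2 := by
  intro x
  induction x using Nat.strong_induction_on with
  | _ x ih =>
    intro y z hx h
    by_cases hc : Nat.Coprime x y
    · exact ⟨x, y, z, hc, h⟩
    · obtain ⟨l, hl, ⟨x, rfl⟩, ⟨y, rfl⟩⟩ := Nat.Prime.not_coprime_iff_dvd.1 hc
      have hz : l ∣ z := by
        refine hl.dvd_of_sq_dvd_mul_sq hq ?_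
        refine (Nat.dvd_add_right (a := l ^ 2) (b := p * (l * y) ^ 2) ⟨p * y ^ 2, by ring⟩).1 ?_
        exact ⟨x ^ 2, by rw [← h]; ring⟩
      obtain ⟨z, rfl⟩ := hz
      have hx0 : x ≠ 0 := by rintro rfl; simp at hx
      refine ih x ?_ y z hx0 ?_
      · have := hl.two_le
        have := Nat.pos_of_ne_zero hx0
        nlinarith
      · have : 0 < l ^ 2 := pow_pos hl.pos 2
        refine Nat.eq_of_mul_eq_mul_left this ?_
        linarith [h, mul_pow l x 2, mul_pow l y 2, mul_pow l z 2,
          show p * (l * y) ^ 2 = l ^ 2 * (p * y ^ 2) by ring,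
          show q * (l * z) ^ 2 = l ^ 2 * (q * z ^ 2) by ring]

theorem sub_sq_lt {n x y : ℕ} (hn : n.Prime) (hx : x ≤ n.sqrt) (hy : y ≤ n.sqrt) :
    ((x : ℤ) - y) ^ 2 < n := by
  have h1 : ((x : ℤ) - y) ^ 2 ≤ (n.sqrt : ℤ) ^ 2 := by
    apply sq_le_sq'
    · have : (y : ℤ) ≤ n.sqrt := by exact_mod_cast hy
      linarith [Int.natCast_nonneg x]
    · have : (x : ℤ) ≤ n.sqrt := by exact_mod_cast hx
      linarith [Int.natCast_nonneg y]
  have h2 : n.sqrt ^ 2 ≤ n := Nat.sqrt_le' n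
  have h3 : n.sqrt ^ 2 ≠ n := by
    intro h
    exact hn.prime.not_isSquare ⟨n.sqrt, by rw [← sq]; exact h.symm⟩
  have h4 : n.sqrt ^ 2 < n := lt_of_le_of_ne h2 h3
  have : ((n.sqrt : ℤ)) ^ 2 < n := by exact_mod_cast h4
  linarith

/-- Legendre's theorem for the form `x² = p y² + q z²` with `p`, `q` distinct primes. -/
theorem exists_sq_eq_mul_sq_add_mul_sq {p q : ℕ} (hp : p.Prime) (hq : q.Prime) (hne : p ≠ q)
    (hpq : IsSquare (p : ZMod q)) (hqp : IsSquare (q : ZMod p)) :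
    ∃ x y z : ℕ, Nat.Coprime x y ∧ x ^ 2 = p * y ^ 2 + q * z ^ 2 := by
  have := Fact.mk hp
  have := Fact.mk hq
  suffices h : ∃ x y z : ℤ, x ≠ 0 ∧ x ^ 2 = p * y ^ 2 + q * z ^ 2 by
    obtain ⟨x, y, z, hx, h⟩ := h
    refine exists_coprime_sq_eq hq x.natAbs y.natAbs z.natAbs (by simpa using hx) ?_
    zify
    simpa using h
  obtain ⟨s, hs⟩ := hpq
  obtain ⟨r, hr⟩ := hqp
  set S := Finset.range ((p * q).sqrt + 1) ×ˢ
    (Finset.range (q.sqrt + 1) ×ˢ Finset.range (p.sqrt + 1)) with hS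
  have hcard : (Finset.univ : Finset (ZMod q × ZMod p)).card < S.card := by
    rw [Finset.card_univ, Fintype.card_prod, ZMod.card, ZMod.card, hS]
    simp only [Finset.card_product, Finset.card_range]
    have h1 := Nat.lt_succ_sqrt (p * q)
    have h2 := Nat.lt_succ_sqrt p
    have h3 := Nat.lt_succ_sqrt q
    simp only [Nat.succ_eq_add_one] at h1 h2 h3
    set A := (p * q).sqrt + 1
    set B := q.sqrt + 1
    set C := p.sqrt + 1
    have h4 : p * q < (C * B) * (C * B) := by
      calc p * q < (C * C) * (B * B) := Nat.mul_lt_mul'' h2 h3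
        _ = _ := by ring
    by_contra! hcon
    have h5 : (A * (B * C)) * (A * (B * C)) ≤ (q * p) * (q * p) := Nat.mul_le_mul hcon hcon
    have h6 : (p * q) * (p * q) < (A * A) * ((C * B) * (C * B)) := Nat.mul_lt_mul'' h1 h4
    nlinarith
  obtain ⟨⟨x₁, y₁, z₁⟩, hm₁, ⟨x₂, y₂, z₂⟩, hm₂, hne', heq⟩ :=
    Finset.exists_ne_map_eq_of_card_lt_of_maps_to hcard
      (f := fun t : ℕ × ℕ × ℕ =>
        (((t.1 : ZMod q) - s * t.2.1, (t.1 : ZMod p) - r * t.2.2) : ZMod q × ZMod p))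
      (fun _ _ => Finset.mem_coe.2 (Finset.mem_univ _))
  simp only [hS, Finset.mem_product, Finset.mem_range, Nat.lt_succ_iff] at hm₁ hm₂
  simp only [Prod.mk.injEq] at heq
  obtain ⟨e1, e2⟩ := heq
  have hy := sub_sq_lt hq hm₁.2.1 hm₂.2.1
  have hz := sub_sq_lt hp hm₁.2.2 hm₂.2.2
  have hx : ((x₁ : ℤ) - x₂) ^ 2 ≤ p * q := by
    have h1 : ((x₁ : ℤ) - x₂) ^ 2 ≤ ((p * q).sqrt : ℤ) ^ 2 := by
      have a1 : (x₁ : ℤ) ≤ (p * q).sqrt := by exact_mod_cast hm₁.1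
      have a2 : (x₂ : ℤ) ≤ (p * q).sqrt := by exact_mod_cast hm₂.1
      apply sq_le_sq' <;> linarith [Int.natCast_nonneg x₁, Int.natCast_nonneg x₂]
    have h2 : (((p * q).sqrt : ℤ)) ^ 2 ≤ p * q := by exact_mod_cast Nat.sqrt_le' (p * q)
    linarith
  obtain ⟨x, hxd⟩ : ∃ x : ℤ, x = (x₁ : ℤ) - x₂ := ⟨_, rfl⟩
  obtain ⟨y, hyd⟩ : ∃ y : ℤ, y = (y₁ : ℤ) - y₂ := ⟨_, rfl⟩
  obtain ⟨z, hzd⟩ : ∃ z : ℤ, z = (z₁ : ℤ) - z₂ := ⟨_, rfl⟩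
  rw [← hxd] at hx
  rw [← hyd] at hy
  rw [← hzd] at hz
  have hnz : ¬ (x = 0 ∧ y = 0 ∧ z = 0) := by
    rintro ⟨rfl, rfl, rfl⟩
    apply hne'
    simp only [Prod.mk.injEq]
    omega
  have dq : (q : ℤ) ∣ x ^ 2 - p * y ^ 2 - q * z ^ 2 := by
    rw [← ZMod.intCast_zmod_eq_zero_iff_dvd, hxd, hyd, hzd]
    push_cast
    have e : (x₁ : ZMod q) - x₂ = s * (y₁ - y₂) := by linear_combination e1
    rw [e, hs, ZMod.natCast_self]
    ring
  have dp : (p : ℤ) ∣ x ^ 2 - p * y ^ 2 - q * z ^ 2 := by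
    rw [← ZMod.intCast_zmod_eq_zero_iff_dvd, hxd, hyd, hzd]
    push_cast
    have e : (x₁ : ZMod p) - x₂ = r * (z₁ - z₂) := by linear_combination e2
    rw [e, hr, ZMod.natCast_self]
    ring
  have hcop : IsCoprime (p : ℤ) (q : ℤ) :=
    Nat.isCoprime_iff_coprime.2 ((Nat.coprime_primes hp hq).2 hne)
  obtain ⟨k, hk⟩ := hcop.mul_dvd dp dq
  have hp0 : (0 : ℤ) < p := by exact_mod_cast hp.pos
  have hq0 : (0 : ℤ) < q := by exact_mod_cast hq.pos
  have hpq0 : (0 : ℤ) < (p : ℤ) * q := mul_pos hp0 hq0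
  have hk1 : -2 < k := by
    by_contra! hc
    nlinarith [sq_nonneg x]
  have hk2 : k ≤ 1 := by
    by_contra! hc
    nlinarith [mul_nonneg hp0.le (sq_nonneg y), mul_nonneg hq0.le (sq_nonneg z)]
  have hk3 : k ≠ 1 := by
    rintro rfl
    have h1 : (p : ℤ) * y ^ 2 ≤ 0 := by nlinarith [mul_nonneg hq0.le (sq_nonneg z)]
    have h2 : x ^ 2 = p * q := by
      nlinarith [mul_nonneg hp0.le (sq_nonneg y), mul_nonneg hq0.le (sq_nonneg z)]
    have h3 : (p : ℤ) ∣ x := (Nat.prime_iff_prime_int.1 hp).dvd_of_dvd_pow ⟨_, h2⟩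
    obtain ⟨w, rfl⟩ := h3
    have h4 : (p : ℤ) ∣ q := ⟨w ^ 2, by
      apply mul_left_cancel₀ hp0.ne'
      linear_combination -h2⟩
    exact hne ((Nat.prime_dvd_prime_iff_eq hp hq).1 (by exact_mod_cast h4))
  have hsq0 : z ^ 2 - (p : ℤ) ≠ 0 := by linarith
  have hcases : k = 0 ∨ k = -1 := by omega
  suffices h : ∃ x y z : ℤ, ¬ (x = 0 ∧ y = 0 ∧ z = 0) ∧ x ^ 2 = p * y ^ 2 + q * z ^ 2 by
    obtain ⟨x, y, z, h1, h2⟩ := h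
    refine ⟨x, y, z, ?_, h2⟩
    rintro rfl
    apply h1
    have a1 := mul_nonneg hp0.le (sq_nonneg y)
    have a2 := mul_nonneg hq0.le (sq_nonneg z)
    have b1 : (p : ℤ) * y ^ 2 = 0 := by linarith
    have b2 : (q : ℤ) * z ^ 2 = 0 := by linarith
    simpa [hp.ne_zero, hq.ne_zero] using And.intro b1 b2
  rcases hcases with rfl | rfl
  · exact ⟨x, y, z, hnz, by linarith⟩
  · refine ⟨x * z + p * y, x + y * z, z ^ 2 - p, fun h => hsq0 h.2.2, ?_⟩
    linear_combination (z ^ 2 - (p : ℤ)) * hk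

/-- The equation `T² - p U² = -1` is solvable for every prime `p ≢ 3 (mod 4)`. -/
theorem exists_sq_add_one_eq_mul_sq {p : ℕ} (hp : p.Prime) (hp4 : p % 4 ≠ 3) :
    ∃ T U : ℕ, T ^ 2 + 1 = p * U ^ 2 := by
  rcases hp.eq_two_or_odd with rfl | hodd
  · exact ⟨1, 1, by norm_num⟩
  have hp1 : p % 4 = 1 := by omega
  have hp0 : (0 : ℤ) < p := by exact_mod_cast hp.pos
  have hpi : Prime (p : ℤ) := Nat.prime_iff_prime_int.1 hp
  have hns : ¬ IsSquare (p : ℤ) := hpi.not_isSquare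
  obtain ⟨a, ha⟩ := Pell.IsFundamental.exists_of_not_isSquare hp0 hns
  obtain ⟨hx, hy, hmin⟩ := ha
  have hprop := a.prop
  obtain ⟨x, hxd⟩ : ∃ x, x = a.x := ⟨_, rfl⟩
  obtain ⟨y, hyd⟩ : ∃ y, y = a.y := ⟨_, rfl⟩
  rw [← hxd, ← hyd] at hprop
  rw [← hxd] at hx hmin
  rw [← hyd] at hy
  obtain ⟨c, hc⟩ : ∃ c : ℤ, (p : ℤ) = 4 * c + 1 := ⟨p / 4, by omega⟩
  have hye : Even y := by
    by_contra h
    obtain ⟨v, rfl⟩ := Int.not_even_iff_odd.1 h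
    rcases Int.even_or_odd' x with ⟨u, rfl | rfl⟩
    · rw [hc] at hprop
      ring_nf at hprop
      omega
    · rw [hc] at hprop
      ring_nf at hprop
      omega
  obtain ⟨v, rfl⟩ := hye
  have hxo : Odd x := by
    by_contra h
    obtain ⟨u, rfl⟩ := Int.not_odd_iff_even.1 h
    ring_nf at hprop
    omega
  obtain ⟨u, rfl⟩ := hxo
  have hu : u * (u + 1) = p * v ^ 2 := by linarith
  have hu0 : 0 < u := by omega
  have hv0 : 0 < v := by omega
  have hcop : IsCoprime u (u + 1) := ⟨-1, 1, by ring⟩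
  have hdvd : (p : ℤ) ∣ u * (u + 1) := ⟨_, hu⟩
  have key : ∀ s t : ℤ, 0 < s → 0 < t → IsCoprime s t → p * s * t = p * v ^ 2 →
      ∃ m n : ℤ, s = m ^ 2 ∧ t = n ^ 2 := by
    intro s t hs ht hst h
    have h1 : s * t = v ^ 2 := by
      apply mul_left_cancel₀ hp0.ne'
      linarith
    obtain ⟨m, hm⟩ := Int.sq_of_isCoprime hst h1
    obtain ⟨n, hn⟩ := Int.sq_of_isCoprime hst.symm (by rw [mul_comm]; exact h1)
    refine ⟨m, n, ?_, ?_⟩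
    · rcases hm with h | h
      · exact h
      · nlinarith [sq_nonneg m]
    · rcases hn with h | h
      · exact h
      · nlinarith [sq_nonneg n]
  rcases hpi.dvd_or_dvd hdvd with ⟨s, hs⟩ | ⟨s, hs⟩
  · exfalso
    have hs0 : 0 < s := by
      by_contra! hcon
      nlinarith
    obtain ⟨m, n, hm, hn⟩ := key s (u + 1) hs0 (by omega)
      (IsCoprime.of_isCoprime_of_dvd_left hcop ⟨p, by rw [hs]; ring⟩) (by rw [← hs]; exact hu)
    have hn1 : 1 < |n| := by
      by_contra! hcon
      have : n ^ 2 ≤ 1 := by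
        rw [← sq_abs]
        nlinarith [abs_nonneg n]
      omega
    have := hmin (b := Pell.Solution₁.mk |n| m (by rw [sq_abs]; linarith [hs, hm ▸ hs])) (by
      rwa [Pell.Solution₁.x_mk])
    rw [Pell.Solution₁.x_mk] at this
    have h3 : n ^ 2 = |n| ^ 2 := (sq_abs n).symm
    nlinarith
  · have hs0 : 0 < s := by
      by_contra! hcon
      nlinarith
    obtain ⟨m, n, hm, hn⟩ := key s u hs0 hu0
      (IsCoprime.of_isCoprime_of_dvd_left hcop.symm ⟨p, by rw [hs]; ring⟩)
      (by rw [← hs, mul_comm]; exact hu)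
    refine ⟨n.natAbs, m.natAbs, ?_⟩
    zify
    rw [sq_abs, sq_abs, ← hm, ← hn]
    exact hs

theorem jacobiSym_eq_one_of_forall_prime {a : ℤ} {b : ℕ}
    (h : ∀ l : ℕ, l.Prime → l ∣ b → ∃ u v : ℤ, (l : ℤ) ∣ a * u ^ 2 - v ^ 2 ∧ ¬ (l : ℤ) ∣ v) :
    J(a | b) = 1 := by
  unfold jacobiSym
  apply List.prod_eq_one
  intro t ht
  obtain ⟨l, hl, rfl⟩ := List.mem_pmap.1 ht
  have hlp := Nat.prime_of_mem_primeFactorsList hl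
  have := Fact.mk hlp
  obtain ⟨u, v, h1, h2⟩ := h l hlp (Nat.dvd_of_mem_primeFactorsList hl)
  rw [← ZMod.intCast_zmod_eq_zero_iff_dvd] at h1 h2
  push_cast at h1
  have hv : (a : ZMod l) * u ^ 2 = v ^ 2 := sub_eq_zero.1 h1
  have hu : (u : ZMod l) ≠ 0 := by
    intro hu
    rw [hu] at hv
    apply h2
    have : (v : ZMod l) ^ 2 = 0 := by rw [← hv]; ring
    exact pow_eq_zero_iff (two_ne_zero) |>.1 this
  have ha : (a : ZMod l) = (v / u) * (v / u) := by
    field_simp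
    linear_combination hv
  rw [legendreSym.eq_one_iff l]
  · exact ⟨_, ha⟩
  · rw [ha]
    exact mul_ne_zero (div_ne_zero h2 hu) (div_ne_zero h2 hu)

theorem jacobiSym_natCast_eq_two_pow {c m k m' : ℕ} (hc : c % 4 = 1) (hm' : Odd m')
    (hm : m = 2 ^ k * m')
    (h : ∀ l : ℕ, l.Prime → l ∣ m →
      ∃ u v : ℤ, (l : ℤ) ∣ c * u ^ 2 - v ^ 2 ∧ ¬ (l : ℤ) ∣ v) :
    J(m | c) = J(2 | c) ^ k := by
  have h1 : J(c | m') = 1 := jacobiSym_eq_one_of_forall_prime fun l hl hlm =>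
    h l hl (hm ▸ hlm.mul_left _)
  rw [hm]
  push_cast
  rw [jacobiSym.mul_left, jacobiSym.pow_left,
    ← jacobiSym.quadratic_reciprocity_one_mod_four hc hm', h1, mul_one]

theorem isSquare_iff_of_mul_eq_sq {F : Type*} [Field F] {a b c : F} (hc : c ≠ 0)
    (h : a * b = c ^ 2) : IsSquare a ↔ IsSquare b := by
  have key : ∀ {a b : F}, a * b = c ^ 2 → IsSquare a → IsSquare b := by
    rintro a b h ⟨d, rfl⟩
    have hd : d ≠ 0 := by
      rintro rfl
      apply hc
      simpa using h.symm
    refine ⟨c / d, ?_⟩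
    field_simp
    linear_combination h
  exact ⟨key h, key (by rw [mul_comm]; exact h)⟩

theorem quartSym_eq_jacobiSym {q a x y : ℕ} (hq : q.Prime) (hq4 : q % 4 = 1) (hx : ¬ q ∣ x)
    (hy : ¬ q ∣ y) (h : (x : ZMod q) ^ 2 = a * y ^ 2) :
    quartSym a q = J(x | q) * J(y | q) := by
  have := Fact.mk hq
  rw [← ZMod.natCast_eq_zero_iff] at hx hy
  have hxy : (((x : ℤ) * y : ℤ) : ZMod q) ≠ 0 := by
    push_cast
    exact mul_ne_zero hx hy
  have hiff : (∃ X : ℤ, (q : ℤ) ∣ X ^ 4 - (a : ℤ)) ↔ IsSquare (((x : ℤ) * y : ℤ) : ZMod q) := by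
    push_cast
    constructor
    · rintro ⟨X, hX⟩
      rw [← ZMod.intCast_zmod_eq_zero_iff_dvd] at hX
      push_cast at hX
      have hX' : (x : ZMod q) ^ 2 = ((X : ZMod q) ^ 2 * y) ^ 2 := by
        linear_combination h - (y : ZMod q) ^ 2 * hX
      obtain ⟨i, hi⟩ := (ZMod.exists_sq_eq_neg_one_iff (p := q)).2 (by omega)
      rcases sq_eq_sq_iff_eq_or_eq_neg.1 hX' with e | e
      · exact ⟨X * y, by rw [e]; ring⟩
      · exact ⟨i * X * y, by rw [e]; linear_combination (X : ZMod q) ^ 2 * y ^ 2 * hi⟩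
    · rintro ⟨w, hw⟩
      obtain ⟨X, hX⟩ := ZMod.intCast_surjective (w / (y : ZMod q))
      refine ⟨X, ?_⟩
      rw [← ZMod.intCast_zmod_eq_zero_iff_dvd]
      push_cast
      rw [hX]
      field_simp
      linear_combination (-(w ^ 2) - (x : ZMod q) * y) * hw + (y : ZMod q) ^ 2 * h
  unfold quartSym
  rw [if_neg (by rintro rfl; omega), ← jacobiSym.mul_left, ← jacobiSym.legendreSym.to_jacobiSym]
  split_ifs with hc
  · exact ((legendreSym.eq_one_iff q hxy).2 (hiff.1 hc)).symm
  · rcases legendreSym.eq_one_or_neg_one q hxy with e | e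
    · exact absurd (hiff.2 ((legendreSym.eq_one_iff q hxy).1 e)) hc
    · exact e.symm

theorem jacobiSym_eq_one_or_neg_one_of_not_dvd {a q : ℕ} (hq : q.Prime) (h : ¬ q ∣ a) :
    J(a | q) = 1 ∨ J(a | q) = -1 := by
  apply jacobiSym.eq_one_or_neg_one
  rw [Int.gcd_natCast_natCast]
  exact ((Nat.Prime.coprime_iff_not_dvd hq).2 h).symm

theorem Nat.exists_sq_eq_eight_mul_add_one {x : ℕ} (hx : Odd x) : ∃ g, x ^ 2 = 8 * g + 1 := by
  obtain ⟨c, rfl⟩ := hx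
  obtain ⟨g, hg⟩ := Nat.even_mul_succ_self c
  exact ⟨g, by linarith⟩

theorem Nat.sq_mod_sixteen_of_odd {x : ℕ} (hx : Odd x) :
    x ^ 2 % 16 = if x % 8 = 1 ∨ x % 8 = 7 then 1 else 9 := by
  have h2 := Nat.odd_iff.1 hx
  have h8 : x % 8 = 1 ∨ x % 8 = 3 ∨ x % 8 = 5 ∨ x % 8 = 7 := by omega
  have h16 : x % 16 = x % 8 ∨ x % 16 = x % 8 + 8 := by omega
  rw [Nat.pow_mod]
  rcases h8 with h | h | h | h <;> rcases h16 with h' | h' <;> rw [h', h] <;> rfl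

theorem mod_four_eq_one_of_sq_add_one {p T U : ℕ} (hT : T ^ 2 + 1 = p * U ^ 2) :
    U % 4 = 1 := by
  have hU : Odd U := by
    by_contra h
    obtain ⟨v, rfl⟩ := Nat.not_odd_iff_even.1 h
    have h4 : (T ^ 2 + 1) % 4 = 0 := by
      rw [hT, show p * (v + v) ^ 2 = 4 * (p * v ^ 2) by ring]
      omega
    rcases Nat.even_or_odd' T with ⟨c, rfl | rfl⟩ <;> ring_nf at h4 <;> omega
  have h1 : J(-1 | U) = 1 := jacobiSym_eq_one_of_forall_prime fun l hl hlU => by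
    refine ⟨1, T, ?_, ?_⟩
    · have : (l : ℤ) ∣ U := by exact_mod_cast hlU
      have hT' : (T : ℤ) ^ 2 + 1 = p * U ^ 2 := by exact_mod_cast hT
      rw [show (-1 : ℤ) * 1 ^ 2 - (T : ℤ) ^ 2 = U * (-(p * U)) by linear_combination -hT']
      exact this.mul_right _
    · intro hlT
      have hlT' : l ∣ T := by exact_mod_cast hlT
      have h2 : l ∣ T ^ 2 + 1 := by
        rw [hT]
        exact (hlU.pow two_ne_zero).mul_left _
      have := (Nat.dvd_add_right (hlT'.pow two_ne_zero)).1 h2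
      exact hl.one_lt.ne' (Nat.dvd_one.1 this)
  rw [jacobiSym.at_neg_one hU, ZMod.χ₄_nat_eq_if_mod_four] at h1
  obtain ⟨v, rfl⟩ := hU
  split_ifs at h1 <;> omega

theorem sign_eq_of_mod_sixteen {x q e : ℕ} {s : ℤ} (hs : s = 1 ∨ s = -1) (hx : x % 2 = 1)
    (hq : q % 8 = 1)
    (h16 : (8 * e ^ 2 + q) % 16 = if x % 8 = 1 ∨ x % 8 = 7 then 1 else 9)
    (hxs : ZMod.χ₄ x * (ZMod.χ₈ x * s) = 1) :
    ZMod.χ₄ (2 * e + x : ℕ) = 1 ↔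
      s * (if (q : ℤ) % 16 = 1 ∨ (q : ℤ) % 16 = 15 then 1 else -1) = 1 := by
  have he : (e % 2 = 0 ∧ e ^ 2 % 2 = 0) ∨ (e % 2 = 1 ∧ e ^ 2 % 2 = 1) := by
    rcases Nat.mod_two_eq_zero_or_one e with h0 | h0
    · exact Or.inl ⟨h0, by rw [Nat.pow_mod, h0]⟩
    · exact Or.inr ⟨h0, by rw [Nat.pow_mod, h0]⟩
  rw [ZMod.χ₄_nat_eq_if_mod_four, ZMod.χ₈_nat_eq_if_mod_eight] at hxs
  rw [ZMod.χ₄_nat_eq_if_mod_four]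
  generalize e ^ 2 = E at *
  rcases hs with rfl | rfl <;> split_ifs at * <;> first | omega | norm_num

section Ternary

variable {p q x y z T U : ℕ}

theorem not_dvd_of_ternary (hp : p.Prime) (hq : q.Prime) (hne : p ≠ q) (hcop : Nat.Coprime x y)
    (h : x ^ 2 = p * y ^ 2 + q * z ^ 2) : ¬ q ∣ x ∧ ¬ q ∣ y ∧ ¬ p ∣ x ∧ ¬ p ∣ z := by
  have hqxy : q ∣ x → q ∣ y → False := fun a b =>
    Nat.not_coprime_of_dvd_of_dvd hq.one_lt a b hcop
  have hpxy : p ∣ x → p ∣ y → False := fun a b =>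
    Nat.not_coprime_of_dvd_of_dvd hp.one_lt a b hcop
  have hqx : ¬ q ∣ x := by
    intro hx
    have h1 : q ∣ p * y ^ 2 :=
      (Nat.dvd_add_left (Dvd.intro (z ^ 2) rfl)).1 (h ▸ hx.pow two_ne_zero)
    rcases hq.dvd_mul.1 h1 with h2 | h2
    · exact hne ((Nat.prime_dvd_prime_iff_eq hq hp).1 h2).symm
    · exact hqxy hx (hq.dvd_of_dvd_pow h2)
  have hpz : ¬ p ∣ z := by
    intro hz
    have hx : p ∣ x := hp.dvd_of_dvd_pow (n := 2) (by
      rw [h]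
      exact (Dvd.intro _ rfl).add ((hz.pow two_ne_zero).mul_left _))
    refine hpxy hx (hp.dvd_of_sq_dvd_mul_sq hp ?_)
    refine (Nat.dvd_add_left ((pow_dvd_pow_of_dvd hz 2).mul_left q)).1 ?_
    rw [← h]
    exact pow_dvd_pow_of_dvd hx 2
  refine ⟨hqx, ?_, ?_, hpz⟩
  · intro hy
    apply hqx
    apply hq.dvd_of_dvd_pow (n := 2)
    rw [h]
    exact ((hy.pow two_ne_zero).mul_left _).add (Dvd.intro _ rfl)
  · intro hx
    have h1 : p ∣ q * z ^ 2 :=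
      (Nat.dvd_add_right (Dvd.intro (y ^ 2) rfl)).1 (h ▸ hx.pow two_ne_zero)
    rcases hp.dvd_mul.1 h1 with h2 | h2
    · exact hne ((Nat.prime_dvd_prime_iff_eq hp hq).1 h2)
    · exact hpz (hp.dvd_of_dvd_pow h2)

theorem isSquare_unit_iff (hq : q.Prime) (hq4 : q % 4 = 1) (hqy : ¬ q ∣ y)
    (h : x ^ 2 = p * y ^ 2 + q * z ^ 2) (hT : T ^ 2 + 1 = p * U ^ 2) {r : ZMod q}
    (hr : r ^ 2 = p) :
    IsSquare ((T : ZMod q) + U * r) ↔ J(y | q) * J((T * y + U * x : ℕ) | q) = 1 := by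
  have := Fact.mk hq
  rw [← ZMod.natCast_eq_zero_iff] at hqy
  have h' : (x : ZMod q) ^ 2 = (r * y) ^ 2 := by
    have := congrArg (Nat.cast : ℕ → ZMod q) h
    push_cast at this
    rw [this, ZMod.natCast_self, ← hr]
    ring
  have hT' : ((T : ZMod q) + U * r) * (T - U * r) = -1 := by
    have := congrArg (Nat.cast : ℕ → ZMod q) hT
    push_cast at this
    linear_combination this - (U : ZMod q) ^ 2 * hr
  have hne1 : (T : ZMod q) + U * r ≠ 0 := by
    intro h0
    simp [h0] at hT'
  have hne2 : (T : ZMod q) - U * r ≠ 0 := by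
    intro h0
    simp [h0] at hT'
  obtain ⟨i, hi⟩ := (ZMod.exists_sq_eq_neg_one_iff (p := q)).2 (by omega)
  have hi0 : i ≠ 0 := by
    rintro rfl
    simp at hi
  rw [← jacobiSym.mul_left, ← jacobiSym.legendreSym.to_jacobiSym]
  rcases sq_eq_sq_iff_eq_or_eq_neg.1 h' with e | e
  · have hn : (T : ZMod q) * y + U * x = y * (T + U * r) := by rw [e]; ring
    rw [legendreSym.eq_one_iff]
    · push_cast
      rw [hn]
      exact isSquare_iff_of_mul_eq_sq (mul_ne_zero hqy hne1) (by ring)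
    · push_cast
      rw [hn]
      exact mul_ne_zero hqy (mul_ne_zero hqy hne1)
  · have hn : (T : ZMod q) * y + U * x = y * (T - U * r) := by rw [e]; ring
    rw [legendreSym.eq_one_iff]
    · push_cast
      rw [hn]
      exact isSquare_iff_of_mul_eq_sq (mul_ne_zero hqy hi0)
        (by linear_combination (y : ZMod q) ^ 2 * hT' + (y : ZMod q) ^ 2 * hi)
    · push_cast
      rw [hn]
      exact mul_ne_zero hqy (mul_ne_zero hqy hne2)

theorem jacobiSym_unit_numerator (hq4 : q % 4 = 1) (hcop : Nat.Coprime x y)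
    (h : x ^ 2 = p * y ^ 2 + q * z ^ 2) (hT : T ^ 2 + 1 = p * U ^ 2)
    (hn : Odd (T * y + U * x)) :
    J((T * y + U * x : ℕ) | q) = ZMod.χ₄ (T * y + U * x : ℕ) := by
  have hZ : (x : ℤ) ^ 2 = p * y ^ 2 + q * z ^ 2 := by exact_mod_cast h
  have hTZ : (T : ℤ) ^ 2 + 1 = p * U ^ 2 := by exact_mod_cast hT
  have h1 : J(-(q : ℤ) | T * y + U * x) = 1 := jacobiSym_eq_one_of_forall_prime fun l hl hln => by
    have hlnZ : (l : ℤ) ∣ T * y + U * x := by exact_mod_cast hln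
    by_cases hlx : l ∣ x
    · have hly : ¬ l ∣ y := fun hly => Nat.not_coprime_of_dvd_of_dvd hl.one_lt hlx hly hcop
      refine ⟨U * z, y, ?_, by exact_mod_cast hly⟩
      rw [show -(q : ℤ) * (U * z) ^ 2 - (y : ℤ) ^ 2 = (T * y + U * x) * (T * y - U * x) by
        linear_combination (U : ℤ) ^ 2 * hZ - (y : ℤ) ^ 2 * hTZ]
      exact hlnZ.mul_right _
    · refine ⟨T * z, x, ?_, by exact_mod_cast hlx⟩
      rw [show -(q : ℤ) * (T * z) ^ 2 - (x : ℤ) ^ 2 = (T * y + U * x) * (p * (T * y - U * x)) by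
        linear_combination (T : ℤ) ^ 2 * hZ - (x : ℤ) ^ 2 * hTZ]
      exact hlnZ.mul_right _
  rw [jacobiSym.neg _ hn, jacobiSym.quadratic_reciprocity_one_mod_four hq4 hn] at h1
  rw [ZMod.χ₄_nat_eq_if_mod_four] at h1 ⊢
  split_ifs at h1 ⊢ <;> omega

theorem jacobiSym_eq_two_pow_of_ternary (hcop : Nat.Coprime x y) (h : x ^ 2 = p * y ^ 2 + q * z ^ 2)
    (hq4 : q % 4 = 1) {k y' : ℕ} (hy' : Odd y') (hy : y = 2 ^ k * y') :
    J(y | q) = J(2 | q) ^ k := by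
  refine jacobiSym_natCast_eq_two_pow hq4 hy' hy fun l hl hly => ⟨z, x, ?_, ?_⟩
  · have hlyZ : (l : ℤ) ∣ y := by exact_mod_cast hly
    have hZ : (x : ℤ) ^ 2 = p * y ^ 2 + q * z ^ 2 := by exact_mod_cast h
    rw [show (q : ℤ) * (z : ℤ) ^ 2 - (x : ℤ) ^ 2 = y * (-(p * y)) by linear_combination -hZ]
    exact hlyZ.mul_right _
  · intro hlx
    exact Nat.not_coprime_of_dvd_of_dvd hl.one_lt (by exact_mod_cast hlx) hly hcop

theorem Nat.Coprime.of_ternary (hp : p.Prime) (hcop : Nat.Coprime x y)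
    (h : x ^ 2 = p * y ^ 2 + q * z ^ 2) : Nat.Coprime x z := by
  by_contra hc
  obtain ⟨l, hl, hlx, hlz⟩ := Nat.Prime.not_coprime_iff_dvd.1 hc
  refine Nat.not_coprime_of_dvd_of_dvd hl.one_lt hlx (hl.dvd_of_sq_dvd_mul_sq hp ?_) hcop
  refine (Nat.dvd_add_left ((pow_dvd_pow_of_dvd hlz 2).mul_left q)).1 ?_
  rw [← h]
  exact pow_dvd_pow_of_dvd hlx 2

theorem jacobiSym_neg_mul_eq_one_of_ternary (hcop : Nat.Coprime x y) (hp : p.Prime) (hpx : ¬ p ∣ x)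
    (h : x ^ 2 = p * y ^ 2 + q * z ^ 2) : J(-((p : ℤ) * q) | x) = 1 := by
  refine jacobiSym_eq_one_of_forall_prime fun l hl hlx => ⟨z, p * y, ?_, ?_⟩
  · have hlxZ : (l : ℤ) ∣ x := by exact_mod_cast hlx
    have hZ : (x : ℤ) ^ 2 = p * y ^ 2 + q * z ^ 2 := by exact_mod_cast h
    rw [show -((p : ℤ) * q) * (z : ℤ) ^ 2 - (p * y : ℤ) ^ 2 = x * (-(p * x)) by
      linear_combination (p : ℤ) * hZ]
    exact hlxZ.mul_right _
  · intro hd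
    have hd' : l ∣ p * y := by exact_mod_cast hd
    rcases hl.dvd_mul.1 hd' with h1 | h1
    · exact hpx (((Nat.prime_dvd_prime_iff_eq hl hp).1 h1) ▸ hlx)
    · exact Nat.not_coprime_of_dvd_of_dvd hl.one_lt hlx h1 hcop

/-- Scholz's law for an odd prime `p`, in terms of a solution of `x² = p y² + q z²`. -/
theorem scholz_of_ternary_of_odd (hp : p.Prime) (hq : q.Prime) (hne : p ≠ q) (hp4 : p % 4 = 1)
    (hq4 : q % 4 = 1) (hcop : Nat.Coprime x y) (h : x ^ 2 = p * y ^ 2 + q * z ^ 2)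
    (hT : T ^ 2 + 1 = p * U ^ 2) {r : ZMod q} (hr : r ^ 2 = p) :
    IsSquare ((T : ZMod q) + U * r) ↔ quartSym (p : ℤ) q * quartSym (q : ℤ) p = 1 := by
  obtain ⟨hqx, hqy, hpx, hpz⟩ := not_dvd_of_ternary hp hq hne hcop h
  have hz0 : z ≠ 0 := by rintro rfl; simp at hpz
  have hcop' := hcop.of_ternary hp h
  have h' : x ^ 2 = q * z ^ 2 + p * y ^ 2 := by rw [h, add_comm]
  have hU := mod_four_eq_one_of_sq_add_one hT
  obtain ⟨a, ha⟩ : ∃ a, p = 4 * a + 1 := ⟨p / 4, by omega⟩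
  obtain ⟨b, hb⟩ : ∃ b, q = 4 * b + 1 := ⟨q / 4, by omega⟩
  obtain ⟨d, hd⟩ : ∃ d, U = 4 * d + 1 := ⟨U / 4, by omega⟩
  have hTe : ∃ t, T = 2 * t := by
    rcases Nat.even_or_odd' T with ⟨t, ht | ht⟩
    · exact ⟨t, ht⟩
    · rw [ht, ha, hd] at hT
      ring_nf at hT
      omega
  obtain ⟨t, ht⟩ := hTe
  have hxodd : Odd x := by
    by_contra hxe
    obtain ⟨c, hc⟩ := Nat.not_odd_iff_even.1 hxe
    have hyo : ¬ Even y := fun hye =>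
      Nat.not_coprime_of_dvd_of_dvd one_lt_two (even_iff_two_dvd.1 ⟨c, hc⟩)
        (even_iff_two_dvd.1 hye) hcop
    obtain ⟨e, he⟩ := Nat.not_even_iff_odd.1 hyo
    rcases Nat.even_or_odd' z with ⟨f, hf | hf⟩ <;>
    · rw [hc, he, hf, ha, hb] at h
      ring_nf at h
      omega
  have hnodd : Odd (T * y + U * x) := by
    have : Odd U := by rw [hd]; exact ⟨2 * d, by ring⟩
    rw [ht, mul_assoc]
    exact (even_two_mul _).add_odd (this.mul hxodd)
  have cast_h : (x : ZMod q) ^ 2 = (p : ZMod q) * y ^ 2 := by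
    have := congrArg (Nat.cast : ℕ → ZMod q) h
    push_cast at this
    rw [this, ZMod.natCast_self]
    ring
  have cast_h' : (x : ZMod p) ^ 2 = (q : ZMod p) * z ^ 2 := by
    have := congrArg (Nat.cast : ℕ → ZMod p) h
    push_cast at this
    rw [this, ZMod.natCast_self]
    ring
  rw [isSquare_unit_iff hq hq4 hqy h hT hr, jacobiSym_unit_numerator hq4 hcop h hT hnodd,
    quartSym_eq_jacobiSym hq hq4 hqx hqy cast_h, quartSym_eq_jacobiSym hp hp4 hpx hpz cast_h']
  have hx1 := jacobiSym_neg_mul_eq_one_of_ternary hcop hp hpx h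
  rw [jacobiSym.neg _ hxodd, jacobiSym.mul_left,
    jacobiSym.quadratic_reciprocity_one_mod_four hp4 hxodd,
    jacobiSym.quadratic_reciprocity_one_mod_four hq4 hxodd] at hx1
  obtain ⟨j, z', hz', hzz⟩ := Nat.exists_eq_two_pow_mul_odd hz0
  have hz1 := jacobiSym_eq_two_pow_of_ternary hcop' h' hp4 hz' hzz
  rw [jacobiSym.at_two (by rw [ha]; exact ⟨2 * a, by ring⟩)] at hz1
  have key : ZMod.χ₄ (T * y + U * x : ℕ) = ZMod.χ₄ (x : ℕ) * ZMod.χ₈ (p : ℕ) ^ j := by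
    obtain ⟨c, hc⟩ := hxodd
    have hp8 : (T % 4 = 0 ∧ p % 8 = 1) ∨ (T % 4 = 2 ∧ p % 8 = 5) := by
      rcases Nat.even_or_odd' t with ⟨u, hu | hu⟩
      · left
        rw [ht, hu, hd] at hT
        refine ⟨by omega, ?_⟩
        ring_nf at hT
        rw [ha] at hT ⊢
        ring_nf at hT
        omega
      · right
        rw [ht, hu, hd] at hT
        refine ⟨by omega, ?_⟩
        ring_nf at hT
        rw [ha] at hT ⊢
        ring_nf at hT
        omega
    have hn4 : (T * y + U * x) % 4 = (T * y + x) % 4 := by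
      rw [hd, show T * y + (4 * d + 1) * x = T * y + x + 4 * (d * x) by ring]
      omega
    rcases Nat.even_or_odd' y with ⟨e, he | he⟩
    · have hj : j = 0 := by
        by_contra hj
        obtain ⟨j, rfl⟩ := Nat.exists_eq_succ_of_ne_zero hj
        have hze : ∃ f, z = 2 * f := ⟨2 ^ j * z', by rw [hzz, pow_succ]; ring⟩
        obtain ⟨f, hf⟩ := hze
        rw [hc, he, hf] at h
        ring_nf at h
        omega
      have hn : (T * y + U * x) % 4 = x % 4 := by
        rw [hn4, ht, he, show 2 * t * (2 * e) + x = x + 4 * (t * e) by ring]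
        omega
      rw [hj, pow_zero, mul_one, ZMod.χ₄_nat_mod_four, hn, ← ZMod.χ₄_nat_mod_four]
    · have hn : (T * y + U * x) % 4 = (T + x) % 4 := by
        rw [hn4, ht, he, show 2 * t * (2 * e + 1) + x = 2 * t + x + 4 * (t * e) by ring]
        omega
      rw [ZMod.χ₄_nat_mod_four, hn, ← ZMod.χ₄_nat_mod_four]
      rcases hp8 with ⟨hT4, hp8⟩ | ⟨hT4, hp8⟩
      · have : ZMod.χ₈ (p : ℕ) = 1 := by
          rw [ZMod.χ₈_nat_eq_if_mod_eight]
          split_ifs <;> omega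
        rw [this, one_pow, mul_one, ZMod.χ₄_nat_mod_four,
          show (T + x) % 4 = x % 4 by omega, ← ZMod.χ₄_nat_mod_four]
      · have h8 : ZMod.χ₈ (p : ℕ) = -1 := by
          rw [ZMod.χ₈_nat_eq_if_mod_eight]
          split_ifs <;> omega
        have hj : j = 1 := by
          obtain ⟨g, hg⟩ := Nat.exists_sq_eq_eight_mul_add_one (x := x) ⟨c, hc⟩
          obtain ⟨g', hg'⟩ := Nat.exists_sq_eq_eight_mul_add_one (x := y) ⟨e, he⟩
          obtain ⟨a', rfl⟩ : ∃ a', p = 8 * a' + 5 := ⟨p / 8, by omega⟩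
          rw [hg, hg'] at h
          rcases j with _ | _ | j
          · rw [pow_zero, one_mul] at hzz
            obtain ⟨f, hf⟩ := Nat.exists_sq_eq_eight_mul_add_one (hzz ▸ hz')
            rw [hf, hb] at h
            ring_nf at h
            omega
          · rfl
          · rw [hzz, show q * (2 ^ (j + 1 + 1) * z') ^ 2 = 16 * (q * (2 ^ j * z') ^ 2) by ring] at h
            ring_nf at h
            omega
        rw [h8, hj, pow_one, ZMod.χ₄_nat_eq_if_mod_four, ZMod.χ₄_nat_eq_if_mod_four]
        split_ifs <;> omega
  rw [key, ← hz1]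
  have hχ : ZMod.χ₄ (x : ℕ) = J(x | p) * J(x | q) := by
    rcases jacobiSym_eq_one_or_neg_one_of_not_dvd hp hpx with e | e <;>
    rcases jacobiSym_eq_one_or_neg_one_of_not_dvd hq hqx with e' | e' <;>
    rw [e, e'] at hx1 ⊢ <;> linarith
  rw [hχ]
  ring_nf

/-- Scholz's law for `p = 2`, in terms of a solution of `x² = 2 y² + q z²`. -/
theorem scholz_of_ternary_of_two (hp2 : p = 2) (hq : q.Prime) (hq8 : q % 8 = 1)
    (hcop : Nat.Coprime x y) (h : x ^ 2 = p * y ^ 2 + q * z ^ 2)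
    (hT : T ^ 2 + 1 = p * U ^ 2) {r : ZMod q} (hr : r ^ 2 = p) :
    IsSquare ((T : ZMod q) + U * r) ↔ quartSym (p : ℤ) q * quartSym (q : ℤ) p = 1 := by
  have hp : p.Prime := hp2 ▸ Nat.prime_two
  have hne : p ≠ q := by omega
  have hq4 : q % 4 = 1 := by omega
  obtain ⟨hqx, hqy, hpx, hpz⟩ := not_dvd_of_ternary hp hq hne hcop h
  have hy0 : y ≠ 0 := by rintro rfl; simp at hqy
  have hU := mod_four_eq_one_of_sq_add_one hT
  have hxodd : Odd x := by
    rw [← Nat.not_even_iff_odd, even_iff_two_dvd]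
    exact hp2 ▸ hpx
  have hzodd : Odd z := by
    rw [← Nat.not_even_iff_odd, even_iff_two_dvd]
    exact hp2 ▸ hpz
  obtain ⟨d, hd⟩ : ∃ d, U = 4 * d + 1 := ⟨U / 4, by omega⟩
  have hTo : ∃ t, T = 2 * t + 1 := by
    rcases Nat.even_or_odd' T with ⟨t, ht | ht⟩
    · rw [ht, hp2] at hT
      ring_nf at hT
      omega
    · exact ⟨t, ht⟩
  obtain ⟨t, ht⟩ := hTo
  have hye : ∃ e, y = 2 * e := by
    rcases Nat.even_or_odd' y with ⟨e, he | he⟩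
    · exact ⟨e, he⟩
    · obtain ⟨g, hg⟩ := Nat.exists_sq_eq_eight_mul_add_one hxodd
      obtain ⟨f, hf⟩ := Nat.exists_sq_eq_eight_mul_add_one hzodd
      obtain ⟨b, hb⟩ : ∃ b, q = 8 * b + 1 := ⟨q / 8, by omega⟩
      rw [hg, hf, he, hb, hp2] at h
      ring_nf at h
      omega
  obtain ⟨e, he⟩ := hye
  have hn4 : (T * y + U * x) % 4 = (2 * e + x) % 4 := by
    rw [hd, ht, he, show (2 * t + 1) * (2 * e) + (4 * d + 1) * x
      = 2 * e + x + 4 * (t * e + d * x) by ring]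
    omega
  have hnodd : Odd (T * y + U * x) := by
    have := Nat.odd_iff.1 hxodd
    rw [Nat.odd_iff]
    omega
  have cast_h : (x : ZMod q) ^ 2 = (p : ZMod q) * y ^ 2 := by
    have := congrArg (Nat.cast : ℕ → ZMod q) h
    push_cast at this
    rw [this, ZMod.natCast_self]
    ring
  rw [isSquare_unit_iff hq hq4 hqy h hT hr, jacobiSym_unit_numerator hq4 hcop h hT hnodd,
    quartSym_eq_jacobiSym hq hq4 hqx hqy cast_h]
  have hx1 := jacobiSym_neg_mul_eq_one_of_ternary hcop hp hpx h
  rw [jacobiSym.neg _ hxodd, jacobiSym.mul_left,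
    jacobiSym.quadratic_reciprocity_one_mod_four hq4 hxodd, hp2, Nat.cast_ofNat,
    jacobiSym.at_two hxodd] at hx1
  obtain ⟨k, y', hy', hyy⟩ := Nat.exists_eq_two_pow_mul_odd hy0
  have hy1 : J(y | q) = 1 := by
    rw [jacobiSym_eq_two_pow_of_ternary hcop h hq4 hy' hyy,
      jacobiSym.at_two (hq.odd_of_ne_two (by omega)), ZMod.χ₈_nat_eq_if_mod_eight, if_neg (by omega), if_pos (by omega), one_pow]
  have hz1 : J((p : ℤ) | z) = 1 := by
    refine jacobiSym_eq_one_of_forall_prime fun l hl hlz => ⟨y, x, ?_, ?_⟩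
    · have hlzZ : (l : ℤ) ∣ z := by exact_mod_cast hlz
      have hZ : (x : ℤ) ^ 2 = p * y ^ 2 + q * z ^ 2 := by exact_mod_cast h
      rw [show (p : ℤ) * (y : ℤ) ^ 2 - (x : ℤ) ^ 2 = z * (-(q * z)) by linear_combination -hZ]
      exact hlzZ.mul_right _
    · intro hlx
      exact Nat.not_coprime_of_dvd_of_dvd hl.one_lt (by exact_mod_cast hlx) hlz
        (hcop.of_ternary hp h)
  rw [hp2, Nat.cast_ofNat, jacobiSym.at_two hzodd, ZMod.χ₈_nat_eq_if_mod_eight] at hz1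
  have hz16 : z ^ 2 % 16 = 1 := by
    rw [Nat.sq_mod_sixteen_of_odd hzodd]
    split_ifs at hz1 ⊢ <;> omega
  have hx16 : (8 * e ^ 2 + q) % 16 = if x % 8 = 1 ∨ x % 8 = 7 then 1 else 9 := by
    rw [← Nat.sq_mod_sixteen_of_odd hxodd, h, hp2, he]
    have : q * z ^ 2 % 16 = q % 16 := by rw [Nat.mul_mod, hz16]; omega
    rw [show 2 * (2 * e) ^ 2 = 8 * e ^ 2 by ring, Nat.add_mod, ← this, ← Nat.add_mod]
  unfold quartSym
  rw [if_pos hp2, hy1, one_mul, mul_one, ZMod.χ₄_nat_mod_four, hn4, ← ZMod.χ₄_nat_mod_four]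
  exact sign_eq_of_mod_sixteen (jacobiSym_eq_one_or_neg_one_of_not_dvd hq hqx)
    (Nat.odd_iff.1 hxodd) hq8 hx16 hx1

end Ternary

/-- Scholz's reciprocity law for an arbitrary unit `T + U√p` of norm `-1`. -/
theorem scholz_of_norm_neg_one {p q T U : ℕ} (hp : p.Prime) (hq : q.Prime) (hne : p ≠ q)
    (hp4 : p % 4 ≠ 3) (hq4 : q % 4 = 1) (hT : T ^ 2 + 1 = p * U ^ 2) {r : ZMod q}
    (hr : r ^ 2 = p) :
    IsSquare ((T : ZMod q) + U * r) ↔ quartSym (p : ℤ) q * quartSym (q : ℤ) p = 1 := by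
  have := Fact.mk hp
  have := Fact.mk hq
  have hpq : IsSquare (p : ZMod q) := ⟨r, by rw [← hr, sq]⟩
  have hq2 : q ≠ 2 := by omega
  rcases hp.eq_two_or_odd with hp2 | hodd
  · have hqp : IsSquare (q : ZMod p) := by
      have hsq : ∀ a : ZMod 2, IsSquare a := by decide
      subst hp2
      exact hsq _
    obtain ⟨x, y, z, hcop, h⟩ := exists_sq_eq_mul_sq_add_mul_sq hp hq hne hpq hqp
    have hq8 : q % 8 = 1 := by
      rw [hp2, Nat.cast_ofNat, ZMod.exists_sq_eq_two_iff hq2] at hpq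
      omega
    exact scholz_of_ternary_of_two hp2 hq hq8 hcop h hT hr
  · have hp1 : p % 4 = 1 := by omega
    have hqp : IsSquare (q : ZMod p) :=
      (ZMod.exists_sq_eq_prime_iff_of_mod_four_eq_one hp1 hq2).2 hpq
    obtain ⟨x, y, z, hcop, h⟩ := exists_sq_eq_mul_sq_add_mul_sq hp hq hne hpq hqp
    exact scholz_of_ternary_of_odd hp hq hne hp1 hq4 hcop h hT hr

theorem exists_rat_zpow_eq {m : ℕ} {u : ℝ} (hu : InO m u) (hu' : InO m u⁻¹) (n : ℤ) :
    ∃ a b : ℚ, u ^ n = (a : ℝ) + b * Real.sqrt m := by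
  have key : ∀ {v : ℝ}, InO m v → ∀ n : ℕ, ∃ a b : ℚ, v ^ n = (a : ℝ) + b * Real.sqrt m := by
    rintro v ⟨⟨a, b, rfl⟩, -⟩ n
    induction n with
    | zero => exact ⟨1, 0, by simp⟩
    | succ n ih =>
      obtain ⟨c, d, h⟩ := ih
      refine ⟨c * a + d * b * m, c * b + d * a, ?_⟩
      rw [pow_succ, h]
      push_cast
      linear_combination (d * b : ℝ) * Real.mul_self_sqrt (Nat.cast_nonneg' (α := ℝ) m)
  rcases Int.eq_nat_or_neg n with ⟨k, rfl | rfl⟩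
  · simpa using key hu k
  · simpa using key hu' k

theorem odd_of_eq_zpow {p T U : ℕ} (hp : p.Prime) (hT : T ^ 2 + 1 = p * U ^ 2) {u : ℝ} (hu0 : u ≠ 0)
    (hu : InO p u) (hu' : InO p u⁻¹) {n : ℤ}
    (h : (T : ℝ) + U * Real.sqrt p = u ^ n ∨ (T : ℝ) + U * Real.sqrt p = -u ^ n) : Odd n := by
  by_contra hn
  obtain ⟨m, rfl⟩ := Int.not_odd_iff_even.1 hn
  have hpos : (0 : ℝ) < (T : ℝ) + U * Real.sqrt p := by
    have hU : 0 < U := by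
      rcases Nat.eq_zero_or_pos U with rfl | hU
      · simp at hT
      · exact hU
    have : (0 : ℝ) < U := by exact_mod_cast hU
    have hp0 : (0 : ℝ) < p := by exact_mod_cast hp.pos
    positivity
  obtain ⟨a, b, hab⟩ := exists_rat_zpow_eq hu hu' m
  rw [zpow_add₀ hu0, hab] at h
  have hsq : (T : ℝ) + U * Real.sqrt p = (a + b * Real.sqrt p) * (a + b * Real.sqrt p) := by
    rcases h with h | h
    · exact h
    · nlinarith [mul_self_nonneg ((a : ℝ) + b * Real.sqrt p)]
  have hss : Real.sqrt p * Real.sqrt p = p := Real.mul_self_sqrt (Nat.cast_nonneg' p)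
  have hirr := hp.irrational_sqrt
  have hlin : ((U - 2 * a * b : ℚ) : ℝ) * Real.sqrt p = ((a ^ 2 + p * b ^ 2 - T : ℚ) : ℝ) := by
    push_cast
    linear_combination hsq + (b : ℝ) ^ 2 * hss
  have hU : (U : ℚ) - 2 * a * b = 0 := by
    by_contra hne
    exact (hirr.ratCast_mul hne) ⟨_, hlin.symm⟩
  have hT' : a ^ 2 + p * b ^ 2 - (T : ℚ) = 0 := by
    rw [hU, Rat.cast_zero, zero_mul] at hlin
    exact_mod_cast hlin.symm
  have hTQ : (T : ℚ) ^ 2 + 1 = p * U ^ 2 := by exact_mod_cast hT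
  rw [show (T : ℚ) = a ^ 2 + p * b ^ 2 by linarith, show (U : ℚ) = 2 * a * b by linarith] at hTQ
  nlinarith [sq_nonneg (a ^ 2 - p * b ^ 2)]

theorem isIntegral_natCast_add_mul_sqrt (p T U : ℕ) :
    IsIntegral ℤ ((T : ℝ) + U * Real.sqrt p) := by
  have hs : IsIntegral ℤ (Real.sqrt p) := by
    refine IsIntegral.of_pow (n := 2) two_pos ?_
    rw [Real.sq_sqrt (Nat.cast_nonneg' p)]
    exact isIntegral_algebraMap (R := ℤ) (x := (p : ℤ))
  have hc : ∀ m : ℕ, IsIntegral ℤ (m : ℝ) := fun m => by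
    simpa using isIntegral_algebraMap (R := ℤ) (A := ℝ) (x := (m : ℤ))
  exact (hc T).add ((hc U).mul hs)

theorem stmt_0 (p q : ℕ) (hp : p.Prime) (hq : q.Prime) (hne : p ≠ q)
    (hp4 : p % 4 ≠ 3) (hq4 : q % 4 ≠ 3) (hqodd : Odd q)
    (hleg : legSym (p : ℤ) q = 1)
    (K : IntermediateField ℚ ℝ)
    (hK : K = IntermediateField.adjoin ℚ {Real.sqrt p})
    (ε : NumberField.RingOfIntegers K)
    (hε : IsFundUnit p ((ε : K) : ℝ)) :
    ∀ φ : NumberField.RingOfIntegers K →+* ZMod q,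
      ((φ ε ≠ 0 ∧ IsSquare (φ ε)) ↔ quartSym (p : ℤ) q * quartSym (q : ℤ) p = 1) := by
  intro φ
  have := Fact.mk hq
  have hq1 : q % 4 = 1 := by
    have := Nat.odd_iff.1 hqodd
    omega
  obtain ⟨T, U, hT⟩ := exists_sq_add_one_eq_mul_sq hp hp4
  obtain ⟨hO, hO', hgt, hgen⟩ := hε
  have hss : Real.sqrt p * Real.sqrt p = p := Real.mul_self_sqrt (Nat.cast_nonneg' p)
  have hTR : (T : ℝ) ^ 2 + 1 = p * U ^ 2 := by exact_mod_cast hT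
  have hinj : Function.Injective (fun a : NumberField.RingOfIntegers K => ((a : K) : ℝ)) :=
    fun a b h => NumberField.RingOfIntegers.ext (Subtype.ext h)
  have hlift : ∀ t : ℝ, t ∈ K → IsIntegral ℤ t →
      ∃ a : NumberField.RingOfIntegers K, ((a : K) : ℝ) = t := by
    intro t ht hint
    refine ⟨⟨⟨t, ht⟩, ?_⟩, rfl⟩
    exact (isIntegral_algHom_iff (K.val.restrictScalars ℤ) Subtype.val_injective).1 hint
  have hsK : Real.sqrt p ∈ K := by
    rw [hK]
    exact IntermediateField.mem_adjoin_simple_self ℚ _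
  obtain ⟨w, hw⟩ := hlift (Real.sqrt p) hsK (by
    simpa using isIntegral_natCast_add_mul_sqrt p 0 1)
  obtain ⟨ε', hε'⟩ := hlift (((ε : K) : ℝ)⁻¹) (K.inv_mem (SetLike.coe_mem _)) hO'.2
  have hε0 : ((ε : K) : ℝ) ≠ 0 := by linarith
  have hmul : ε * ε' = 1 := by
    apply hinj
    simp [hε', hε0]
  set η : NumberField.RingOfIntegers K := T + U * w with hη
  have hηR : ((η : K) : ℝ) = T + U * Real.sqrt p := by
    simp [hη, hw]
  have hInO : InO p ((T : ℝ) + U * Real.sqrt p) :=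
    ⟨⟨T, U, by simp⟩, isIntegral_natCast_add_mul_sqrt p T U⟩
  have hinv : ((T : ℝ) + U * Real.sqrt p)⁻¹ = -T + U * Real.sqrt p := by
    apply inv_eq_of_mul_eq_one_right
    linear_combination (U : ℝ) ^ 2 * hss - hTR
  have hInO' : InO p ((T : ℝ) + U * Real.sqrt p)⁻¹ := by
    rw [hinv]
    refine ⟨⟨-T, U, by simp⟩, ?_⟩
    rw [show -(T : ℝ) + U * Real.sqrt p = (((0 : ℕ) : ℝ) + ((2 * U : ℕ) : ℝ) * Real.sqrt p) -
      (T + U * Real.sqrt p) by push_cast; ring]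
    exact (isIntegral_natCast_add_mul_sqrt p 0 (2 * U)).sub (isIntegral_natCast_add_mul_sqrt p T U)
  obtain ⟨n, hn⟩ := hgen _ hInO hInO'
  have hnodd := odd_of_eq_zpow hp hT hε0 hO hO' hn
  have hr : φ w ^ 2 = p := by
    rw [← map_pow, ← map_natCast φ]
    congr 1
    apply hinj
    simp [hw]
  have hφη : φ η = T + U * φ w := by simp [hη]
  have hφε : φ ε ≠ 0 := by
    intro h0
    have := congrArg φ hmul
    simp [h0] at this
  rw [← scholz_of_norm_neg_one hp hq hne hp4 hq1 hT hr, ← hφη]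
  simp only [ne_eq, hφε, not_false_eq_true, true_and]
  obtain ⟨m, rfl⟩ := hnodd
  let u : (NumberField.RingOfIntegers K)ˣ := ⟨ε, ε', hmul, by rw [mul_comm]; exact hmul⟩
  have hu : ∀ k : ℤ, ((((u ^ k : (NumberField.RingOfIntegers K)ˣ) :
      NumberField.RingOfIntegers K) : K) : ℝ) = ((ε : K) : ℝ) ^ k := by
    intro k
    let f : NumberField.RingOfIntegers K →+* ℝ :=
      (algebraMap K ℝ).comp (algebraMap (NumberField.RingOfIntegers K) K)
    have h1 := congrArg Units.val (map_zpow (Units.map (f : NumberField.RingOfIntegers K →* ℝ)) u k)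
    rw [Units.val_zpow_eq_zpow_val] at h1
    exact h1
  have hφu : φ ((u ^ (m + 1) : (NumberField.RingOfIntegers K)ˣ) :
      NumberField.RingOfIntegers K) ≠ 0 :=
    ((u ^ (m + 1)).isUnit.map φ).ne_zero
  have hz : ((ε : K) : ℝ) ^ (2 * m + 1) * ((ε : K) : ℝ) = (((ε : K) : ℝ) ^ (m + 1)) ^ 2 := by
    rw [← zpow_add_one₀ hε0, ← zpow_natCast, ← zpow_mul]
    congr 1
    push_cast
    ring
  obtain ⟨i, hi⟩ := (ZMod.exists_sq_eq_neg_one_iff (p := q)).2 hq4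
  have hi0 : i ≠ 0 := by
    rintro rfl
    simp at hi
  rcases hn with hn | hn
  · have hprod : ε * η = ((u ^ (m + 1) : (NumberField.RingOfIntegers K)ˣ) :
        NumberField.RingOfIntegers K) ^ 2 := by
      apply hinj
      have h1 := hu (m + 1)
      simp only [map_mul, map_pow, MulMemClass.coe_mul, SubmonoidClass.coe_pow, h1, hηR, hn, ← hz]
      ring
    refine isSquare_iff_of_mul_eq_sq hφu ?_
    rw [← map_mul, hprod, map_pow]
  · have hprod : ε * η = -((u ^ (m + 1) : (NumberField.RingOfIntegers K)ˣ) :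
        NumberField.RingOfIntegers K) ^ 2 := by
      apply hinj
      have h1 := hu (m + 1)
      simp only [map_mul, map_pow, map_neg, NegMemClass.coe_neg, MulMemClass.coe_mul,
        SubmonoidClass.coe_pow, h1, hηR, hn, ← hz]
      ring
    refine isSquare_iff_of_mul_eq_sq (mul_ne_zero hi0 hφu) ?_
    rw [← map_mul, hprod, map_neg, map_pow]
    linear_combination φ ((u ^ (m + 1) : (NumberField.RingOfIntegers K)ˣ) :
      NumberField.RingOfIntegers K) ^ 2 * hi
end

section
/- Let m > 1 be an odd squarefree integer and let x, y be integers with x² − m y² = −1 and y > 0. Then: (a) every prime divisor of m·y is congruent to 1 modulo 4; (b) x is even; (c) x ≡ 0 (mod 4) if and only if m ≡ 1 (mod 8); (d) y ≡ 1 (mod 4). -/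
theorem Nat.mod_four_eq_one_of_forall_prime_dvd {n : ℕ} (hn : n ≠ 0)
    (h : ∀ p : ℕ, p.Prime → p ∣ n → p % 4 = 1) : n % 4 = 1 := by
  induction n using induction_on_primes with
  | zero => exact absurd rfl hn
  | one => rfl
  | prime_mul p a hp ih =>
    have hpmod := h p hp (dvd_mul_right p a)
    have hamod := ih (right_ne_zero_of_mul hn) fun q hq hqa => h q hq (hqa.mul_left p)
    simp [Nat.mul_mod, hpmod, hamod]

theorem Nat.Prime.mod_four_ne_three_of_dvd_sq_add_one {p : ℕ} (hp : p.Prime) {x : ℤ}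
    (h : (p : ℤ) ∣ x ^ 2 + 1) : p % 4 ≠ 3 := by
  have : Fact p.Prime := ⟨hp⟩
  have hx := (ZMod.intCast_zmod_eq_zero_iff_dvd _ p).2 h
  push_cast at hx
  exact ZMod.mod_four_ne_three_of_sq_eq_neg_one (eq_neg_of_add_eq_zero_left hx)

theorem Int.odd_of_sq_sub_mul_sq_eq_neg_one {m x y : ℤ} (h : x ^ 2 - m * y ^ 2 = -1) :
    Odd y := by
  by_contra hy
  obtain ⟨k, rfl⟩ := even_iff_two_dvd.1 (Int.not_odd_iff_even.1 hy)
  have hx : x ^ 2 = 4 * (m * k ^ 2) - 1 := by linear_combination h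
  rcases Int.even_or_odd x with ⟨a, rfl⟩ | ⟨a, rfl⟩ <;> ring_nf at hx <;> omega

theorem stmt_2 (m : ℤ) (hm : 1 < m) (hodd : Odd m) (hsf : Squarefree m)
    (x y : ℤ) (hxy : x ^ 2 - m * y ^ 2 = -1) (hy : 0 < y) :
    (∀ p : ℕ, p.Prime → (p : ℤ) ∣ m * y → p % 4 = 1) ∧
    Even x ∧ ((4 : ℤ) ∣ x ↔ m % 8 = 1) ∧ y % 4 = 1 := by
  have hyodd := Int.odd_of_sq_sub_mul_sq_eq_neg_one hxy
  have hprime : ∀ p : ℕ, p.Prime → (p : ℤ) ∣ m * y → p % 4 = 1 := by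
    intro p hp hdvd
    have hpodd : Odd (p : ℤ) := by
      obtain ⟨c, hc⟩ := hdvd
      exact (Int.odd_mul.1 (hc ▸ hodd.mul hyodd)).1
    have hne := hp.mod_four_ne_three_of_dvd_sq_add_one (x := x)
      (by rw [show x ^ 2 + 1 = m * y * y by linear_combination hxy]; exact hdvd.mul_right y)
    have := Int.odd_iff.1 hpodd
    omega
  have hx : Even x := by
    have hsq : Even (x ^ 2) := by
      rw [show x ^ 2 = m * y ^ 2 - 1 by linear_combination hxy]
      exact (hodd.mul hyodd.pow).sub_odd odd_one
    exact (Int.even_pow.1 hsq).1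
  refine ⟨hprime, hx, ?_, ?_⟩
  · obtain ⟨a, rfl⟩ := even_iff_two_dvd.1 hx
    have hy8 : y ^ 2 ≡ 1 [ZMOD 8] :=
      (Int.modEq_iff_dvd.2 (Int.eight_dvd_sq_sub_one_of_odd hyodd)).symm
    have hm8 : (2 * a) ^ 2 + 1 ≡ m [ZMOD 8] := by
      rw [show (2 * a) ^ 2 + 1 = m * y ^ 2 by linear_combination hxy]
      simpa using hy8.mul_left m
    unfold Int.ModEq at hm8
    rcases Int.even_or_odd' a with ⟨b, rfl | rfl⟩ <;> ring_nf at hm8 <;> omega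
  · lift y to ℕ using hy.le
    have := Nat.mod_four_eq_one_of_forall_prime_dvd (n := y) (by omega)
      fun p hp hpy => hprime p hp ((Int.natCast_dvd_natCast.2 hpy).mul_left m)
    omega
end

section
/- Let m > 1 be a squarefree integer such that Nε_m = 1, and let p₁, …, p_t be all the prime divisors of m. Set E = ℚ(√p₁, …, √p_t) ⊆ ℝ if m ≢ 3 (mod 4), and E = ℚ(√2, √p₁, …, √p_t) ⊆ ℝ if m ≡ 3 (mod 4). Then ε_m is a square in E; that is, there exists β ∈ E with β² = ε_m. -/
/-- The norm of `ε ∈ ℚ(√m)` from `ℚ(√m)` to `ℚ` equals `1`. -/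
def NormPosOne (m : ℕ) (ε : ℝ) : Prop :=
  ∃ a b : ℚ, ε = (a : ℝ) + (b : ℝ) * Real.sqrt m ∧ a ^ 2 - (m : ℚ) * b ^ 2 = 1

/-- A subfield of `ℝ` containing the square roots of all prime divisors of `n` contains `√n`. -/
lemma sqrt_natCast_mem_of_forall_prime_dvd (E : IntermediateField ℚ ℝ) (n : ℕ)
    (h : ∀ p : ℕ, p.Prime → p ∣ n → Real.sqrt p ∈ E) : Real.sqrt n ∈ E := by
  induction n using induction_on_primes with
  | zero => simp
  | one => simp
  | prime_mul p a hp ih =>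
    rw [Nat.cast_mul, Real.sqrt_mul (Nat.cast_nonneg p)]
    exact E.mul_mem (h p hp (dvd_mul_right p a))
      (ih fun q hq hqa => h q hq (hqa.mul_left p))

/-- A rational number whose square becomes an integer after multiplication by a squarefree
natural number is itself an integer. -/
lemma exists_int_eq_of_squarefree_mul_sq {m : ℕ} (hsf : Squarefree m) {q : ℚ} {k : ℤ}
    (h : (m : ℚ) * q ^ 2 = k) : ∃ n : ℤ, q = n := by
  have hd : (q.den : ℚ) ≠ 0 := by exact_mod_cast q.den_ne_zero
  have h1 : (m : ℤ) * q.num ^ 2 = k * (q.den : ℤ) ^ 2 := by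
    have : (m : ℚ) * (q.num : ℚ) ^ 2 = k * (q.den : ℚ) ^ 2 := by
      rw [← h, mul_assoc, ← mul_pow, Rat.mul_den_eq_num]
    exact_mod_cast this
  have hcop : IsCoprime ((q.den : ℤ) ^ 2) (q.num ^ 2) := by
    refine IsCoprime.pow ?_
    rw [Int.isCoprime_iff_gcd_eq_one, Int.gcd_comm]
    exact q.reduced
  have h2 : (q.den : ℤ) ^ 2 ∣ m := hcop.dvd_of_dvd_mul_right ⟨k, by rw [h1]; ring⟩
  have h3 : q.den * q.den ∣ m := by
    rw [← sq]
    exact_mod_cast h2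
  have h4 : q.den = 1 := Nat.isUnit_iff.mp (hsf _ h3)
  exact ⟨q.num, (Rat.coe_int_num_of_den_eq_one h4).symm⟩

/-- If `M (M + 4) = m B ^ 2` and `m ≡ 1 (mod 4)`, then `M + 4` has even `2`-adic valuation. -/
lemma even_padicValNat_two_of_mul_add_four {m M B : ℕ} (hm : m % 4 = 1) (hM : 0 < M)
    (hB : B ≠ 0) (h : (M + 4) * M = m * B ^ 2) : Even (padicValNat 2 (M + 4)) := by
  have hval := congrArg (padicValNat 2) h
  rw [padicValNat.mul (by omega) (by omega), padicValNat.mul (by omega) (by positivity),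
    padicValNat.pow, padicValNat.eq_zero_of_not_dvd (n := m) (by omega)] at hval
  have hfour (j : ℕ) (hj : ¬ 2 ∣ j) : padicValNat 2 (4 * j) = 2 := by
    rw [show 4 * j = 2 ^ 2 * j by ring, padicValNat.mul (by norm_num) (by omega),
      padicValNat.prime_pow, padicValNat.eq_zero_of_not_dvd hj]
  rcases Nat.even_or_odd M with hev | hodd
  · obtain ⟨k, hk⟩ := hev
    rcases Nat.even_or_odd k with hkev | hkodd
    · obtain ⟨j, hj⟩ := hkev
      rcases Nat.even_or_odd j with hje | hjo
      · have := hfour (j + 1) (by grind)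
        rw [show 4 * (j + 1) = M + 4 by omega] at this
        rw [this]
        exact even_two
      · have := hfour j (by grind)
        rw [show 4 * j = M by omega] at this
        rw [this] at hval
        grind
    · exfalso
      obtain ⟨i, rfl⟩ := hkodd
      have hBe : Even B := by
        by_contra hB'
        have : Odd (m * B ^ 2) :=
          (Nat.odd_iff.mpr (by omega : m % 2 = 1)).mul (Nat.not_even_iff_odd.mp hB').pow
        rw [← h, hk] at this
        grind
      obtain ⟨c, rfl⟩ := hBe
      have h' : (2 * i + 3) * (2 * i + 1) = m * c ^ 2 := by
        subst hk
        nlinarith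
      have hmod := congrArg (· % 4) h'
      have hl : (2 * i + 3) * (2 * i + 1) % 4 = 3 := by
        rw [show (2 * i + 3) * (2 * i + 1) = 3 + 4 * (i * i + 2 * i) by ring]
        omega
      have hr : m * c ^ 2 % 4 ≠ 3 := by
        rw [Nat.mul_mod, hm, Nat.pow_mod]
        have : c % 4 < 4 := Nat.mod_lt _ (by norm_num)
        interval_cases c % 4 <;> norm_num
      exact hr (by omega)
  · rw [padicValNat.eq_zero_of_not_dvd (by grind)]
    exact Even.zero

/-- If `M (M + 4) = m B ^ 2`, then a prime dividing `M + 4` to an odd power divides `m`,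
except possibly for the prime `2` when `m ≡ 3 (mod 4)`. -/
lemma prime_dvd_or_eq_two_of_odd_padicValNat {m M B p : ℕ} (hm : m ≠ 0) (hM : 0 < M)
    (hp : p.Prime) (h : (M + 4) * M = m * B ^ 2) (hodd : Odd (padicValNat p (M + 4))) :
    p ∣ m ∨ p = 2 ∧ m % 4 = 3 := by
  have := Fact.mk hp
  have hB : B ≠ 0 := by
    rintro rfl
    have : 0 < (M + 4) * M := by positivity
    simp at h
    omega
  by_cases hpm : p ∣ m
  · exact Or.inl hpm
  refine Or.inr ?_
  have hval := congrArg (padicValNat p) h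
  rw [padicValNat.mul (by omega) (by omega), padicValNat.mul hm (by positivity),
    padicValNat.pow, padicValNat.eq_zero_of_not_dvd hpm] at hval
  have hpN : p ∣ M + 4 := dvd_of_one_le_padicValNat hodd.pos
  have hpM : p ∣ M := dvd_of_one_le_padicValNat (by grind)
  have hp4 : p ∣ 2 ^ 2 := (Nat.dvd_add_right hpM).mp hpN
  have hp2 : p = 2 := (Nat.prime_dvd_prime_iff_eq hp Nat.prime_two).mp (hp.dvd_of_dvd_pow hp4)
  subst hp2
  refine ⟨rfl, ?_⟩
  by_contra h3
  exact Nat.not_even_iff_odd.mpr hodd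
    (even_padicValNat_two_of_mul_add_four (by omega) hM hB h)

/-- If every prime dividing `n` to an odd power has its square root in `E`, then `√n ∈ E`. -/
lemma sqrt_natCast_mem_of_odd_padicValNat (E : IntermediateField ℚ ℝ) {n : ℕ} (hn : n ≠ 0)
    (h : ∀ p : ℕ, p.Prime → Odd (padicValNat p n) → Real.sqrt p ∈ E) : Real.sqrt n ∈ E := by
  obtain ⟨s, r, hsr, hs⟩ := Nat.sq_mul_squarefree n
  have hr0 : r ≠ 0 := by rintro rfl; simp at hsr; omega
  have hs0 : s ≠ 0 := hs.ne_zero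
  rw [← hsr, Nat.cast_mul, Nat.cast_pow, Real.sqrt_mul (by positivity),
    Real.sqrt_sq (Nat.cast_nonneg r)]
  refine E.mul_mem (natCast_mem E r) (sqrt_natCast_mem_of_forall_prime_dvd E s fun p hp hps => ?_)
  have := Fact.mk hp
  refine h p hp ?_
  have hle : s.factorization p ≤ 1 := hs.natFactorization_le_one p
  rw [Nat.factorization_def s hp] at hle
  have hge := one_le_padicValNat_of_dvd hs0 hps
  rw [← hsr, padicValNat.mul (by positivity) hs0, padicValNat.pow,
    le_antisymm hle hge]
  exact ⟨_, rfl⟩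

/-- If `x` and `y` are integral over `ℤ` and their sum is rational, the sum is an integer. -/
lemma exists_int_eq_of_isIntegral_add {x y : ℝ} (hx : IsIntegral ℤ x) (hy : IsIntegral ℤ y)
    {q : ℚ} (h : x + y = q) : ∃ n : ℤ, q = n := by
  have hq : IsIntegral ℤ (algebraMap ℚ ℝ q) := by
    rw [eq_ratCast, ← h]
    exact hx.add hy
  rw [isIntegral_algebraMap_iff (algebraMap ℚ ℝ).injective] at hq
  obtain ⟨n, hn⟩ := IsIntegrallyClosed.isIntegral_iff.mp hq
  exact ⟨n, by simpa using hn.symm⟩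

theorem stmt_7 (m : ℕ) (hm : 1 < m) (hsf : Squarefree m)
    (ε : ℝ) (hε : IsFundUnit m ε) (hN : NormPosOne m ε)
    (E : IntermediateField ℚ ℝ)
    (hE : E = IntermediateField.adjoin ℚ
      ({x : ℝ | ∃ p : ℕ, p.Prime ∧ p ∣ m ∧ x = Real.sqrt p} ∪
        (if m % 4 = 3 then {Real.sqrt 2} else ∅))) :
    ∃ β : ℝ, β ∈ E ∧ β ^ 2 = ε := by
  obtain ⟨⟨-, hintegral⟩, ⟨-, hintegral_inv⟩, h1, -⟩ := hε
  obtain ⟨a, b, hab, hnorm⟩ := hN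
  have hnormR : (a : ℝ) ^ 2 - m * (b : ℝ) ^ 2 = 1 := by exact_mod_cast hnorm
  have hm0 : (0 : ℝ) ≤ m := Nat.cast_nonneg m
  have hsq : Real.sqrt m ^ 2 = m := Real.sq_sqrt hm0
  have hinv : ε⁻¹ = a - b * Real.sqrt m := by
    refine inv_eq_of_mul_eq_one_right ?_
    rw [hab]
    linear_combination hnormR - (b : ℝ) ^ 2 * hsq
  have hlt : ε⁻¹ < 1 := inv_lt_one_of_one_lt₀ h1
  have hbm : 0 < (b : ℝ) * Real.sqrt m := by linarith
  have ha : 1 < (a : ℝ) := by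
    have : 0 < ε⁻¹ := by positivity
    nlinarith
  obtain ⟨T, hT⟩ := exists_int_eq_of_isIntegral_add hintegral hintegral_inv (q := 2 * a) (by
    rw [hinv, hab]; push_cast; ring)
  obtain ⟨B, hB⟩ := exists_int_eq_of_squarefree_mul_sq hsf (q := 2 * b) (k := T ^ 2 - 4) (by
    push_cast
    rw [← hT]
    linear_combination -4 * hnorm)
  have hTR : 2 * (a : ℝ) = T := by exact_mod_cast hT
  have hT2 : 2 < T := by
    have : (2 : ℝ) < T := by linarith
    exact_mod_cast this
  obtain ⟨M, hM⟩ := Int.eq_ofNat_of_zero_le (show 0 ≤ T - 2 by omega)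
  have hMR : (M : ℝ) = 2 * a - 2 := by
    rw [hTR]
    exact_mod_cast hM.symm
  have hM0 : 0 < M := by omega
  have heq : (M + 4) * M = m * B.natAbs ^ 2 := by
    zify
    rw [sq_abs, ← hM]
    have : ((T : ℚ) - 2 + 4) * (T - 2) = m * (B : ℚ) ^ 2 := by
      rw [← hT, ← hB]
      linear_combination 4 * hnorm
    exact_mod_cast this
  have hprime (p : ℕ) (hp : p.Prime) (hpm : p ∣ m) : Real.sqrt p ∈ E := by
    rw [hE]
    exact IntermediateField.subset_adjoin _ _ (Or.inl ⟨p, hp, hpm, rfl⟩)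
  have hmE : Real.sqrt m ∈ E := sqrt_natCast_mem_of_forall_prime_dvd E m hprime
  have hNE : Real.sqrt (M + 4 : ℕ) ∈ E := by
    refine sqrt_natCast_mem_of_odd_padicValNat E (by omega) fun p hp hodd => ?_
    rcases prime_dvd_or_eq_two_of_odd_padicValNat (by omega) hM0 hp heq hodd with
      hpm | ⟨rfl, h3⟩
    · exact hprime p hp hpm
    · rw [hE]
      refine IntermediateField.subset_adjoin _ _ (Or.inr ?_)
      simp [h3]
  have hN0 : 0 < Real.sqrt (M + 4 : ℕ) := Real.sqrt_pos.mpr (by positivity)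
  have hmul : Real.sqrt (M + 4 : ℕ) * Real.sqrt M = 2 * b * Real.sqrt m := by
    rw [← Real.sqrt_mul (Nat.cast_nonneg _), Real.sqrt_eq_iff_mul_self_eq_of_pos (by linarith)]
    push_cast
    rw [hMR]
    linear_combination 4 * (b : ℝ) ^ 2 * hsq - 4 * hnormR
  have hME : Real.sqrt M ∈ E := by
    rw [eq_div_of_mul_eq hN0.ne' ((mul_comm _ _).trans hmul)]
    exact E.div_mem (E.mul_mem (E.mul_mem (ofNat_mem E 2) (E.algebraMap_mem b)) hmE) hNE
  refine ⟨(Real.sqrt (M + 4 : ℕ) + Real.sqrt M) / 2,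
    E.div_mem (E.add_mem hNE hME) (ofNat_mem E 2), ?_⟩
  have e1 : Real.sqrt (M + 4 : ℕ) ^ 2 = M + 4 := by
    rw [Real.sq_sqrt (Nat.cast_nonneg _)]
    push_cast
    ring
  have e2 : Real.sqrt M ^ 2 = M := Real.sq_sqrt (Nat.cast_nonneg _)
  rw [hab]
  linear_combination e1 / 4 + e2 / 4 + hmul / 2 + hMR / 2
end
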